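/- Let d ≥ 5 and 0 < p ≤ d - 4. For every n ≥ 1, the function (x_1, …, x_n) ↦ E|√x_1 ξ_1 + … + √x_n ξ_n|^{-p} is Schur-concave on ℝ_+^n: if x, y ∈ ℝ_+^n and x is majorized by y, then E|√y_1 ξ_1 + … + √y_n ξ_n|^{-p} ≤ E|√x_1 ξ_1 + … + √x_n ξ_n|^{-p}. -/

import Mathlib

open MeasureTheory Real Set
open scoped ENNReal

/-- `μ` is the uniform probability measure on the unit sphere `S^{d-1}` in `ℝ^d`:
it is supported on the unit sphere and invariant under every orthogonal map. -/
def IsUniformOnSphere {d : ℕ} (μ : Measure (EuclideanSpace ℝ (Fin d))) : Prop :=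
  μ (Metric.sphere (0 : EuclideanSpace ℝ (Fin d)) 1)ᶜ = 0 ∧
  ∀ Q : EuclideanSpace ℝ (Fin d) ≃ₗᵢ[ℝ] EuclideanSpace ℝ (Fin d), μ.map ⇑Q = μ

/-- `x` is majorized by `y` : every partial sum of the `k` largest entries of `x`
is at most the corresponding sum for `y` (expressed via: the sum of `x` over any
subset is dominated by the sum of `y` over some subset of the same cardinality),
and the total sums agree. -/
def MajorizedBy {n : ℕ} (x y : Fin n → ℝ) : Prop :=
  (∀ S : Finset (Fin n), ∃ T : Finset (Fin n),
      T.card = S.card ∧ ∑ i ∈ S, x i ≤ ∑ i ∈ T, y i) ∧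
  ∑ i, x i = ∑ i, y i

namespace IsUniformOnSphere

variable {d : ℕ} {μ : Measure (EuclideanSpace ℝ (Fin d))}

theorem ae_mem_sphere (hμ : IsUniformOnSphere μ) :
    ∀ᵐ x ∂μ, x ∈ Metric.sphere (0 : EuclideanSpace ℝ (Fin d)) 1 :=
  hμ.1

theorem restrict_sphere (hμ : IsUniformOnSphere μ) :
    μ.restrict (Metric.sphere (0 : EuclideanSpace ℝ (Fin d)) 1) = μ :=
  Measure.restrict_eq_self_of_ae_mem hμ.ae_mem_sphere

theorem measurePreserving (hμ : IsUniformOnSphere μ)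
    (Q : EuclideanSpace ℝ (Fin d) ≃ₗᵢ[ℝ] EuclideanSpace ℝ (Fin d)) :
    MeasurePreserving Q μ μ :=
  ⟨Q.continuous.measurable, hμ.2 Q⟩

theorem integral_comp (hμ : IsUniformOnSphere μ)
    (Q : EuclideanSpace ℝ (Fin d) ≃ₗᵢ[ℝ] EuclideanSpace ℝ (Fin d))
    (f : EuclideanSpace ℝ (Fin d) → ℝ) : ∫ x, f (Q x) ∂μ = ∫ x, f x ∂μ :=
  (hμ.measurePreserving Q).integral_comp Q.toHomeomorph.measurableEmbedding f

theorem lintegral_comp (hμ : IsUniformOnSphere μ)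
    (Q : EuclideanSpace ℝ (Fin d) ≃ₗᵢ[ℝ] EuclideanSpace ℝ (Fin d))
    (f : EuclideanSpace ℝ (Fin d) → ℝ≥0∞) : ∫⁻ x, f (Q x) ∂μ = ∫⁻ x, f x ∂μ :=
  (hμ.measurePreserving Q).lintegral_comp_emb Q.toHomeomorph.measurableEmbedding f

theorem integrable_of_continuousOn [IsProbabilityMeasure μ] (hμ : IsUniformOnSphere μ)
    {f : EuclideanSpace ℝ (Fin d) → ℝ} (hf : ContinuousOn f (Metric.sphere 0 1)) :
    Integrable f μ := by
  have h : IntegrableOn f (Metric.sphere 0 1) μ :=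
    hf.integrableOn_compact (isCompact_sphere _ _)
  rwa [IntegrableOn, hμ.restrict_sphere] at h

/-- Differentiation under the integral sign for a uniform measure on the sphere. -/
theorem hasDerivAt_integral [IsProbabilityMeasure μ] (hμ : IsUniformOnSphere μ)
    {G G' : ℝ → EuclideanSpace ℝ (Fin d) → ℝ}
    (hG : ∀ s, ContinuousOn (G s) (Metric.sphere 0 1))
    (hG' : ContinuousOn (Function.uncurry G') (univ ×ˢ Metric.sphere 0 1))
    (hd : ∀ s, ∀ x ∈ Metric.sphere (0 : EuclideanSpace ℝ (Fin d)) 1,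
      HasDerivAt (fun s => G s x) (G' s x) s) (s₀ : ℝ) :
    HasDerivAt (fun s => ∫ x, G s x ∂μ) (∫ x, G' s₀ x ∂μ) s₀ := by
  have hK : IsCompact (Icc (s₀ - 1) (s₀ + 1) ×ˢ
      Metric.sphere (0 : EuclideanSpace ℝ (Fin d)) 1) :=
    isCompact_Icc.prod (isCompact_sphere _ _)
  obtain ⟨C, hC⟩ := hK.exists_bound_of_continuousOn
    (hG'.mono (prod_mono (subset_univ _) subset_rfl))
  have hG's : ContinuousOn (G' s₀) (Metric.sphere 0 1) :=
    hG'.comp (f := fun x => (s₀, x)) (by fun_prop) (fun x hx => ⟨mem_univ _, hx⟩)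
  refine (hasDerivAt_integral_of_dominated_loc_of_deriv_le (F := G) (F' := G')
    (bound := fun _ => C) (Icc_mem_nhds (by linarith : s₀ - 1 < s₀) (by linarith : s₀ < s₀ + 1))
    (Filter.Eventually.of_forall fun s =>
      (hμ.integrable_of_continuousOn (hG s)).aestronglyMeasurable)
    (hμ.integrable_of_continuousOn (hG s₀))
    (hμ.integrable_of_continuousOn hG's).aestronglyMeasurable ?_ (integrable_const _) ?_).2
  · filter_upwards [hμ.ae_mem_sphere] with x hx s hs
    exact hC (s, x) ⟨hs, hx⟩
  · filter_upwards [hμ.ae_mem_sphere] with x hx s _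
    exact hd s x hx

theorem coord_mem_Icc {x : EuclideanSpace ℝ (Fin d)} (hx : x ∈ Metric.sphere 0 1)
    (i : Fin d) : x i ∈ Icc (-1 : ℝ) 1 := by
  have h := EuclideanSpace.norm_eq x
  have h1 : ‖x i‖ ≤ ‖x‖ := PiLp.norm_apply_le x i
  rw [mem_sphere_zero_iff_norm.1 hx, Real.norm_eq_abs, abs_le] at h1
  exact h1

/-- The infinitesimal form of invariance under rotations in the plane of the `i`-th and
`j`-th coordinates. -/
theorem integral_sq_mul_deriv [IsProbabilityMeasure μ] (hμ : IsUniformOnSphere μ)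
    {i j : Fin d} (hij : i ≠ j) {h h' : ℝ → ℝ}
    (hh : ∀ t ∈ Icc (-1 : ℝ) 1, HasDerivAt h (h' t) t) (hc : ContinuousOn h' (Icc (-1) 1)) :
    ∫ x, x j ^ 2 * h' (x i) ∂μ = ∫ x, x i * h (x i) ∂μ := by
  set v : ℝ → EuclideanSpace ℝ (Fin d) := fun s =>
    EuclideanSpace.single i 1 + s • EuclideanSpace.single j 1 with hv
  set Q := fun s => Submodule.reflection (Submodule.span ℝ {v s}) with hQ
  have hvn : ∀ s, ‖v s‖ ^ 2 = 1 + s ^ 2 := by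
    intro s
    rw [hv, norm_add_sq_real]
    simp [norm_smul, inner_smul_right, EuclideanSpace.inner_single_left, hij.symm]
  have hQi : ∀ s x, (Q s x) i = 2 * ((x i + s * x j) / (1 + s ^ 2)) - x i := by
    intro s x
    simp only [hQ, Submodule.reflection_singleton_apply]
    simp [hvn]
    simp [hv, inner_add_left, inner_smul_left,
      EuclideanSpace.inner_single_left, hij]
  have hQj : ∀ s x, (Q s x) j = 2 * ((x i + s * x j) / (1 + s ^ 2) * s) - x j := by
    intro s x
    simp only [hQ, Submodule.reflection_singleton_apply]
    simp [hvn]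
    simp [hv, inner_add_left, inner_smul_left,
      EuclideanSpace.inner_single_left, hij.symm]
  have hmem : ∀ s, ∀ x ∈ Metric.sphere (0 : EuclideanSpace ℝ (Fin d)) 1,
      2 * ((x i + s * x j) / (1 + s ^ 2)) - x i ∈ Icc (-1 : ℝ) 1 := by
    intro s x hx
    rw [← hQi]
    refine coord_mem_Icc ?_ i
    rw [mem_sphere_zero_iff_norm] at hx ⊢
    rw [LinearIsometryEquiv.norm_map, hx]
  have hpos : ∀ s : ℝ, 1 + s ^ 2 ≠ 0 := fun s => by positivity
  have hhc : ContinuousOn h (Icc (-1) 1) := fun t ht => (hh t ht).continuousAt.continuousWithinAt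
  have hder := hμ.hasDerivAt_integral
    (G := fun s x => (2 * ((x i + s * x j) / (1 + s ^ 2) * s) - x j) *
      h (2 * ((x i + s * x j) / (1 + s ^ 2)) - x i))
    (G' := fun s x =>
      (2 * ((x j * (1 + s ^ 2) - (x i + s * x j) * (2 * s)) / (1 + s ^ 2) ^ 2 * s +
        (x i + s * x j) / (1 + s ^ 2))) * h (2 * ((x i + s * x j) / (1 + s ^ 2)) - x i) +
      (2 * ((x i + s * x j) / (1 + s ^ 2) * s) - x j) *
        (h' (2 * ((x i + s * x j) / (1 + s ^ 2)) - x i) *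
          (2 * ((x j * (1 + s ^ 2) - (x i + s * x j) * (2 * s)) / (1 + s ^ 2) ^ 2))))
    ?_ ?_ ?_ 0
  · have hconst : (fun s => ∫ x, (2 * ((x i + s * x j) / (1 + s ^ 2) * s) - x j) *
        h (2 * ((x i + s * x j) / (1 + s ^ 2)) - x i) ∂μ) = fun _ => ∫ x, x j * h (x i) ∂μ := by
      funext s
      rw [← hμ.integral_comp (Q s) fun x => x j * h (x i)]
      simp only [hQi, hQj]
    rw [hconst] at hder
    have h0 := hder.unique (hasDerivAt_const 0 _)
    have hxi : ContinuousOn (fun x : EuclideanSpace ℝ (Fin d) => h (x i)) (Metric.sphere 0 1) :=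
      hhc.comp (by fun_prop) fun x hx => coord_mem_Icc hx i
    have hxi' : ContinuousOn (fun x : EuclideanSpace ℝ (Fin d) => h' (x i)) (Metric.sphere 0 1) :=
      hc.comp (by fun_prop) fun x hx => coord_mem_Icc hx i
    have hI : Integrable (fun x => x i * h (x i)) μ :=
      hμ.integrable_of_continuousOn ((Continuous.continuousOn (by fun_prop)).mul hxi)
    have hI' : Integrable (fun x => x j ^ 2 * h' (x i)) μ :=
      hμ.integrable_of_continuousOn ((Continuous.continuousOn (by fun_prop)).mul hxi')
    have h1 : ∫ x, 2 * (x i * h (x i) - x j ^ 2 * h' (x i)) ∂μ = 0 := by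
      rw [← h0]
      refine integral_congr_ae (Filter.Eventually.of_forall fun x => ?_)
      ring_nf
    rw [integral_const_mul, integral_sub hI hI'] at h1
    linarith
  · intro s
    exact ContinuousOn.mul (by fun_prop) (hhc.comp (by fun_prop) (hmem s))
  · have hm : MapsTo (fun z : ℝ × EuclideanSpace ℝ (Fin d) =>
        2 * ((z.2 i + z.1 * z.2 j) / (1 + z.1 ^ 2)) - z.2 i)
        (univ ×ˢ Metric.sphere 0 1) (Icc (-1) 1) := fun z hz => hmem z.1 z.2 hz.2
    have c1 : Continuous fun z : ℝ × EuclideanSpace ℝ (Fin d) =>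
        (z.2 i + z.1 * z.2 j) / (1 + z.1 ^ 2) :=
      Continuous.div (by fun_prop) (by fun_prop) fun z => hpos _
    have c2 : Continuous fun z : ℝ × EuclideanSpace ℝ (Fin d) =>
        (z.2 j * (1 + z.1 ^ 2) - (z.2 i + z.1 * z.2 j) * (2 * z.1)) / (1 + z.1 ^ 2) ^ 2 :=
      Continuous.div (by fun_prop) (by fun_prop) fun z => pow_ne_zero _ (hpos _)
    have c3 := hhc.comp (f := fun z : ℝ × EuclideanSpace ℝ (Fin d) =>
      2 * ((z.2 i + z.1 * z.2 j) / (1 + z.1 ^ 2)) - z.2 i) (by fun_prop) hm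
    have c4 := hc.comp (f := fun z : ℝ × EuclideanSpace ℝ (Fin d) =>
      2 * ((z.2 i + z.1 * z.2 j) / (1 + z.1 ^ 2)) - z.2 i) (by fun_prop) hm
    simp only [Function.comp_def] at c3 c4
    simp only [Function.uncurry_def]
    exact ((Continuous.continuousOn (by fun_prop)).mul c3).add
      ((Continuous.continuousOn (by fun_prop)).mul
        (c4.mul (Continuous.continuousOn (by fun_prop))))
  · intro s x hx
    have e1 : HasDerivAt (fun s : ℝ => (x i + s * x j) / (1 + s ^ 2))
        ((x j * (1 + s ^ 2) - (x i + s * x j) * (2 * s)) / (1 + s ^ 2) ^ 2) s := by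
      refine HasDerivAt.div ?_ ?_ (hpos s)
      · simpa using ((hasDerivAt_id s).mul_const (x j)).const_add (x i)
      · simpa using ((hasDerivAt_id s).pow 2).const_add 1
    have e2 := ((e1.mul (hasDerivAt_id s)).const_mul 2).sub_const (x j)
    have e3 := (hh _ (hmem s x hx)).comp s ((e1.const_mul 2).sub_const (x i))
    refine (e2.mul e3).congr_deriv ?_
    simp

/-- Integration by parts for functions of one coordinate on the sphere. -/
theorem integral_one_sub_sq_mul_deriv [IsProbabilityMeasure μ] (hμ : IsUniformOnSphere μ)
    (i : Fin d) {h h' : ℝ → ℝ}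
    (hh : ∀ t ∈ Icc (-1 : ℝ) 1, HasDerivAt h (h' t) t) (hc : ContinuousOn h' (Icc (-1) 1)) :
    ∫ x, (1 - x i ^ 2) * h' (x i) ∂μ = ((d : ℝ) - 1) * ∫ x, x i * h (x i) ∂μ := by
  have hxi' : ContinuousOn (fun x : EuclideanSpace ℝ (Fin d) => h' (x i)) (Metric.sphere 0 1) :=
    hc.comp (by fun_prop) fun x hx => coord_mem_Icc hx i
  have hI : ∀ j, Integrable (fun x => x j ^ 2 * h' (x i)) μ := fun j =>
    hμ.integrable_of_continuousOn ((Continuous.continuousOn (by fun_prop)).mul hxi')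
  have h1 : ∫ x, (1 - x i ^ 2) * h' (x i) ∂μ =
      ∫ x, ∑ j ∈ Finset.univ.erase i, x j ^ 2 * h' (x i) ∂μ := by
    refine integral_congr_ae ?_
    filter_upwards [hμ.ae_mem_sphere] with x hx
    have hn := EuclideanSpace.real_norm_sq_eq x
    rw [mem_sphere_zero_iff_norm.1 hx, ← Finset.add_sum_erase _ _ (Finset.mem_univ i)] at hn
    rw [← Finset.sum_mul]
    congr 1
    linarith
  rw [h1, integral_finsetSum _ fun j _ => hI j,
    Finset.sum_congr rfl fun j hj => hμ.integral_sq_mul_deriv (Finset.ne_of_mem_erase hj).symm hh hc]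
  have hd : 1 ≤ d := Nat.one_le_iff_ne_zero.2 fun h => by subst h; exact i.elim0
  simp [Nat.cast_sub hd]

end IsUniformOnSphere


section RadialODE

variable {m : ℕ} {D g : ℝ → ℝ}

/-- If `(r ^ (m + 1) D)' = r ^ (m + 1) g` with `g` nonnegative, then `D` is nonnegative. -/
theorem nonneg_of_hasDerivAt_pow_mul
    (hD : ∀ r, HasDerivAt (fun r => r ^ (m + 1) * D r) (r ^ (m + 1) * g r) r)
    (hg : ∀ r, 0 ≤ r → 0 ≤ g r) {r : ℝ} (hr : 0 < r) : 0 ≤ D r := by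
  have hmono : MonotoneOn (fun r => r ^ (m + 1) * D r) (Ici 0) := by
    refine monotoneOn_of_deriv_nonneg (convex_Ici 0)
      (fun r _ => (hD r).continuousAt.continuousWithinAt)
      (fun r _ => (hD r).differentiableAt.differentiableWithinAt) fun r hr => ?_
    rw [interior_Ici, mem_Ioi] at hr
    rw [(hD r).deriv]
    exact mul_nonneg (by positivity) (hg r hr.le)
  have h := hmono self_mem_Ici (mem_Ici.2 hr.le) hr.le
  simp only [ne_eq, Nat.add_eq_zero_iff, one_ne_zero, and_false, not_false_eq_true, zero_pow,
    zero_mul] at h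
  exact nonneg_of_mul_nonneg_right h (by positivity)

/-- If `(r ^ (m + 1) D)' = r ^ (m + 1) g` with `g` nondecreasing, then `D r / r` is
nondecreasing. -/
theorem monotoneOn_div_of_hasDerivAt_pow_mul
    (hD : ∀ r, HasDerivAt (fun r => r ^ (m + 1) * D r) (r ^ (m + 1) * g r) r)
    (hg : MonotoneOn g (Ici 0)) : MonotoneOn (fun r => D r / r) (Ioi 0) := by
  have hpow : ∀ r : ℝ, HasDerivAt (fun r : ℝ => r ^ (m + 2)) (((m : ℝ) + 2) * r ^ (m + 1)) r := by
    intro r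
    simpa using hasDerivAt_pow (m + 2) r
  have hK : ∀ r, 0 < r → ((m : ℝ) + 2) * (r ^ (m + 1) * D r) ≤ r ^ (m + 2) * g r := by
    intro r hr
    have hder : ∀ s, HasDerivAt (fun s => s ^ (m + 2) * g r - ((m : ℝ) + 2) * (s ^ (m + 1) * D s))
        (((m : ℝ) + 2) * s ^ (m + 1) * g r - ((m : ℝ) + 2) * (s ^ (m + 1) * g s)) s := fun s =>
      ((hpow s).mul_const (g r)).sub ((hD s).const_mul _)
    have hmono : MonotoneOn
        (fun s => s ^ (m + 2) * g r - ((m : ℝ) + 2) * (s ^ (m + 1) * D s)) (Icc 0 r) := by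
      refine monotoneOn_of_deriv_nonneg (convex_Icc 0 r)
        (fun s _ => (hder s).continuousAt.continuousWithinAt)
        (fun s _ => (hder s).differentiableAt.differentiableWithinAt) fun s hs => ?_
      rw [interior_Icc] at hs
      rw [(hder s).deriv]
      have h1 : g s ≤ g r := hg hs.1.le hr.le hs.2.le
      have h2 : 0 ≤ ((m : ℝ) + 2) * s ^ (m + 1) := by have := hs.1; positivity
      nlinarith [mul_le_mul_of_nonneg_left h1 h2]
    have h := hmono (left_mem_Icc.2 hr.le) (right_mem_Icc.2 hr.le) hr.le
    simp only [ne_eq, Nat.add_eq_zero_iff, one_ne_zero, OfNat.ofNat_ne_zero, and_false,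
      not_false_eq_true, zero_pow, zero_mul, mul_zero, sub_zero] at h
    linarith
  have hquot : ∀ r, 0 < r → HasDerivAt (fun r => r ^ (m + 1) * D r / r ^ (m + 2))
      ((r ^ (m + 1) * g r * r ^ (m + 2) - r ^ (m + 1) * D r * (((m : ℝ) + 2) * r ^ (m + 1))) /
        (r ^ (m + 2)) ^ 2) r := fun r hr => (hD r).div (hpow r) (by positivity)
  have hmono : MonotoneOn (fun r => r ^ (m + 1) * D r / r ^ (m + 2)) (Ioi 0) := by
    refine monotoneOn_of_deriv_nonneg (convex_Ioi 0)
      (fun s hs => (hquot s hs).continuousAt.continuousWithinAt)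
      (fun s hs => ?_) fun s hs => ?_
    · rw [interior_Ioi] at hs
      exact (hquot s hs).differentiableAt.differentiableWithinAt
    · rw [interior_Ioi] at hs
      have hs' : 0 < s := hs
      rw [(hquot s hs).deriv]
      refine div_nonneg ?_ (by positivity)
      have h2 : 0 ≤ s ^ (m + 1) := by positivity
      nlinarith [mul_le_mul_of_nonneg_left (hK s hs) h2]
  refine hmono.congr fun r hr => ?_
  have hr' : r ≠ 0 := ne_of_gt hr
  simp only
  field_simp
  ring

/-- If `A' = D` and `D r / r` is nondecreasing, then `τ ↦ A (√τ)` is convex. -/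
theorem convexOn_comp_sqrt {A : ℝ → ℝ} (hA : ∀ r, HasDerivAt A (D r) r)
    (hmono : MonotoneOn (fun r => D r / r) (Ioi 0)) :
    ConvexOn ℝ (Ici 0) fun τ => A (√τ) := by
  have hc : Continuous A := continuous_iff_continuousAt.2 fun r => (hA r).continuousAt
  have hder : ∀ τ, 0 < τ → HasDerivAt (fun τ => A (√τ)) (D (√τ) / √τ / 2) τ := by
    intro τ hτ
    refine ((hA _).comp τ (hasDerivAt_sqrt hτ.ne')).congr_deriv ?_
    have : √τ ≠ 0 := (sqrt_pos.2 hτ).ne'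
    field_simp
  refine MonotoneOn.convexOn_of_deriv (convex_Ici 0) (hc.comp continuous_sqrt).continuousOn ?_ ?_
  · intro τ hτ
    rw [interior_Ici] at hτ
    exact (hder τ hτ).differentiableAt.differentiableWithinAt
  · intro τ hτ τ' hτ' h
    rw [interior_Ici] at hτ hτ'
    rw [(hder τ hτ).deriv, (hder τ' hτ').deriv]
    have := hmono (sqrt_pos.2 hτ) (sqrt_pos.2 hτ') (sqrt_le_sqrt h)
    simp only at this
    linarith

end RadialODE

/-- The mean of the radial function `x ↦ φ (‖x‖ ^ 2)` over the sphere of radius `r` centred at a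
point of norm `b` on the `i`-th axis. -/
noncomputable def sphereMean {d : ℕ} (μ : Measure (EuclideanSpace ℝ (Fin d))) (i : Fin d)
    (φ : ℝ → ℝ) (b r : ℝ) : ℝ :=
  ∫ x, φ (r ^ 2 + b ^ 2 + 2 * r * b * x i) ∂μ

theorem sq_add_sq_add_nonneg (r b : ℝ) {t : ℝ} (ht : t ∈ Icc (-1 : ℝ) 1) :
    0 ≤ r ^ 2 + b ^ 2 + 2 * r * b * t := by
  have h : 0 ≤ (1 - t) * (1 + t) := mul_nonneg (by linarith [ht.2]) (by linarith [ht.1])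
  nlinarith [sq_nonneg (r + b * t), mul_nonneg (sq_nonneg b) h]

namespace IsUniformOnSphere

variable {d : ℕ} {μ : Measure (EuclideanSpace ℝ (Fin d))} {i : Fin d}

theorem sphereMean_congr (hμ : IsUniformOnSphere μ) {φ ψ : ℝ → ℝ}
    (h : ∀ σ, 0 ≤ σ → φ σ = ψ σ) (b r : ℝ) : sphereMean μ i φ b r = sphereMean μ i ψ b r := by
  refine integral_congr_ae ?_
  filter_upwards [hμ.ae_mem_sphere] with x hx
  exact h _ (sq_add_sq_add_nonneg r b (coord_mem_Icc hx i))

theorem sphereMean_nonneg (hμ : IsUniformOnSphere μ) {φ : ℝ → ℝ}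
    (h : ∀ σ, 0 ≤ σ → 0 ≤ φ σ) (b r : ℝ) : 0 ≤ sphereMean μ i φ b r := by
  refine integral_nonneg_of_ae ?_
  filter_upwards [hμ.ae_mem_sphere] with x hx
  exact h _ (sq_add_sq_add_nonneg r b (coord_mem_Icc hx i))

variable {φ φ' φ'' : ℝ → ℝ}

theorem continuousOn_comp_coord (hφ : ContinuousOn φ (Ici 0)) (b : ℝ) :
    ContinuousOn (fun z : ℝ × EuclideanSpace ℝ (Fin d) =>
      φ (z.1 ^ 2 + b ^ 2 + 2 * z.1 * b * z.2 i)) (univ ×ˢ Metric.sphere 0 1) :=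
  hφ.comp (by fun_prop) fun z hz => sq_add_sq_add_nonneg z.1 b (coord_mem_Icc hz.2 i)

theorem continuousOn_comp_coord_right (hφ : ContinuousOn φ (Ici 0)) (b r : ℝ) :
    ContinuousOn (fun x : EuclideanSpace ℝ (Fin d) =>
      φ (r ^ 2 + b ^ 2 + 2 * r * b * x i)) (Metric.sphere 0 1) :=
  hφ.comp (by fun_prop) fun _ hx => sq_add_sq_add_nonneg r b (coord_mem_Icc hx i)

theorem hasDerivAt_sphereMean [IsProbabilityMeasure μ] (hμ : IsUniformOnSphere μ)
    (hφ : ∀ σ, 0 ≤ σ → HasDerivAt φ (φ' σ) σ) (hc : ContinuousOn φ' (Ici 0)) (b r : ℝ) :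
    HasDerivAt (sphereMean μ i φ b)
      (∫ x, φ' (r ^ 2 + b ^ 2 + 2 * r * b * x i) * (2 * r + 2 * b * x i) ∂μ) r := by
  have hφc : ContinuousOn φ (Ici 0) := fun σ hσ => (hφ σ hσ).continuousAt.continuousWithinAt
  refine hμ.hasDerivAt_integral (G := fun r x => φ (r ^ 2 + b ^ 2 + 2 * r * b * x i))
    (G' := fun r x => φ' (r ^ 2 + b ^ 2 + 2 * r * b * x i) * (2 * r + 2 * b * x i))
    (fun s => continuousOn_comp_coord_right hφc b s) ?_ ?_ r
  · exact (continuousOn_comp_coord hc b).mul (Continuous.continuousOn (by fun_prop))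
  · intro s x hx
    refine (hφ _ (sq_add_sq_add_nonneg s b (coord_mem_Icc hx i))).comp s
      (h := fun s => s ^ 2 + b ^ 2 + 2 * s * b * x i) ?_
    refine (((hasDerivAt_pow 2 s).add_const (b ^ 2)).add
      ((((hasDerivAt_id s).const_mul 2).mul_const b).mul_const (x i))).congr_deriv ?_
    simp

/-- The Darboux equation for spherical means of a radial function. -/
theorem hasDerivAt_pow_mul_deriv_sphereMean [IsProbabilityMeasure μ] (hμ : IsUniformOnSphere μ)
    {m : ℕ} (hd : d = m + 2)
    (hφ' : ∀ σ, 0 ≤ σ → HasDerivAt φ' (φ'' σ) σ) (hc : ContinuousOn φ'' (Ici 0)) (b r : ℝ) :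
    HasDerivAt (fun r => r ^ (m + 1) *
        ∫ x, φ' (r ^ 2 + b ^ 2 + 2 * r * b * x i) * (2 * r + 2 * b * x i) ∂μ)
      (r ^ (m + 1) * sphereMean μ i (fun σ => 4 * σ * φ'' σ + 2 * d * φ' σ) b r) r := by
  have hφc : ContinuousOn φ' (Ici 0) := fun σ hσ => (hφ' σ hσ).continuousAt.continuousWithinAt
  have hder := hμ.hasDerivAt_integral
    (G := fun r x => φ' (r ^ 2 + b ^ 2 + 2 * r * b * x i) * (2 * r + 2 * b * x i))
    (G' := fun r x => φ'' (r ^ 2 + b ^ 2 + 2 * r * b * x i) * (2 * r + 2 * b * x i) *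
      (2 * r + 2 * b * x i) + φ' (r ^ 2 + b ^ 2 + 2 * r * b * x i) * 2)
    (fun s => (continuousOn_comp_coord_right hφc b s).mul (Continuous.continuousOn (by fun_prop)))
    ((((continuousOn_comp_coord hc b).mul (Continuous.continuousOn (by fun_prop))).mul
      (Continuous.continuousOn (by fun_prop))).add
      ((continuousOn_comp_coord hφc b).mul continuousOn_const)) ?_ r
  · refine ((hasDerivAt_pow (m + 1) r).mul hder).congr_deriv ?_
    have ibp := hμ.integral_one_sub_sq_mul_deriv i
      (h := fun t => φ' (r ^ 2 + b ^ 2 + 2 * r * b * t))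
      (h' := fun t => φ'' (r ^ 2 + b ^ 2 + 2 * r * b * t) * (2 * r * b)) ?_ ?_
    · have c0 := continuousOn_comp_coord_right (i := i) hφc b r
      have c2 := continuousOn_comp_coord_right (i := i) hc b r
      have I0 : Integrable (fun x => φ' (r ^ 2 + b ^ 2 + 2 * r * b * x i)) μ :=
        hμ.integrable_of_continuousOn c0
      have I1 : Integrable (fun x => x i * φ' (r ^ 2 + b ^ 2 + 2 * r * b * x i)) μ :=
        hμ.integrable_of_continuousOn ((Continuous.continuousOn (by fun_prop)).mul c0)
      have I2 : Integrable (fun x => (1 - x i ^ 2) *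
          φ'' (r ^ 2 + b ^ 2 + 2 * r * b * x i)) μ :=
        hμ.integrable_of_continuousOn ((Continuous.continuousOn (by fun_prop)).mul c2)
      have I3 : Integrable (fun x => (r + b * x i) ^ 2 *
          φ'' (r ^ 2 + b ^ 2 + 2 * r * b * x i)) μ :=
        hμ.integrable_of_continuousOn ((Continuous.continuousOn (by fun_prop)).mul c2)
      have e1 : ∫ x, φ' (r ^ 2 + b ^ 2 + 2 * r * b * x i) * (2 * r + 2 * b * x i) ∂μ =
          2 * r * ∫ x, φ' (r ^ 2 + b ^ 2 + 2 * r * b * x i) ∂μ +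
          2 * b * ∫ x, x i * φ' (r ^ 2 + b ^ 2 + 2 * r * b * x i) ∂μ := by
        rw [← integral_const_mul, ← integral_const_mul,
          ← integral_add (I0.const_mul _) (I1.const_mul _)]
        congr 1 with x
        ring
      have e2 : ∫ x, (φ'' (r ^ 2 + b ^ 2 + 2 * r * b * x i) * (2 * r + 2 * b * x i) *
          (2 * r + 2 * b * x i) + φ' (r ^ 2 + b ^ 2 + 2 * r * b * x i) * 2) ∂μ =
          4 * ∫ x, (r + b * x i) ^ 2 * φ'' (r ^ 2 + b ^ 2 + 2 * r * b * x i) ∂μ +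
          2 * ∫ x, φ' (r ^ 2 + b ^ 2 + 2 * r * b * x i) ∂μ := by
        rw [← integral_const_mul, ← integral_const_mul,
          ← integral_add (I3.const_mul _) (I0.const_mul _)]
        congr 1 with x
        ring
      have e3 : sphereMean μ i (fun σ => 4 * σ * φ'' σ + 2 * d * φ' σ) b r =
          4 * ∫ x, (r + b * x i) ^ 2 * φ'' (r ^ 2 + b ^ 2 + 2 * r * b * x i) ∂μ +
          (4 * b ^ 2 * ∫ x, (1 - x i ^ 2) * φ'' (r ^ 2 + b ^ 2 + 2 * r * b * x i) ∂μ +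
          2 * d * ∫ x, φ' (r ^ 2 + b ^ 2 + 2 * r * b * x i) ∂μ) := by
        rw [sphereMean, ← integral_const_mul, ← integral_const_mul, ← integral_const_mul,
          ← integral_add' (I2.const_mul _) (I0.const_mul _),
          ← integral_add' (I3.const_mul _) ((I2.const_mul _).add (I0.const_mul _))]
        congr 1 with x
        simp only [Pi.add_apply]
        ring
      have e4 : ∫ x, (1 - x i ^ 2) * (φ'' (r ^ 2 + b ^ 2 + 2 * r * b * x i) * (2 * r * b)) ∂μ =
          2 * r * b * ∫ x, (1 - x i ^ 2) * φ'' (r ^ 2 + b ^ 2 + 2 * r * b * x i) ∂μ := by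
        rw [← integral_const_mul]
        congr 1 with x
        ring
      rw [e4] at ibp
      rw [e1, e2, e3]
      have hdm : (d : ℝ) = m + 2 := by exact_mod_cast hd
      rw [hdm] at ibp ⊢
      push_cast
      linear_combination (-2 * b * r ^ m) * ibp
    · intro t ht
      refine (hφ' _ (sq_add_sq_add_nonneg r b ht)).comp t
        (h := fun t => r ^ 2 + b ^ 2 + 2 * r * b * t) ?_
      simpa using ((hasDerivAt_id t).const_mul (2 * r * b)).const_add (r ^ 2 + b ^ 2)
    · exact (hc.comp (by fun_prop) fun t ht => sq_add_sq_add_nonneg r b ht).mul continuousOn_const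
  · intro s x hx
    have h1 : HasDerivAt (fun s => s ^ 2 + b ^ 2 + 2 * s * b * x i) (2 * s + 2 * b * x i) s := by
      refine (((hasDerivAt_pow 2 s).add_const (b ^ 2)).add
        ((((hasDerivAt_id s).const_mul 2).mul_const b).mul_const (x i))).congr_deriv ?_
      simp
    have h2 := (hφ' _ (sq_add_sq_add_nonneg s b (coord_mem_Icc hx i))).comp s h1
    refine (h2.mul (((hasDerivAt_id s).const_mul 2).add_const (2 * b * x i))).congr_deriv ?_
    simp

theorem monotoneOn_sphereMean [IsProbabilityMeasure μ] (hμ : IsUniformOnSphere μ) (hd : 2 ≤ d)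
    (hφ : ∀ σ, 0 ≤ σ → HasDerivAt φ (φ' σ) σ) (hφ' : ∀ σ, 0 ≤ σ → HasDerivAt φ' (φ'' σ) σ)
    (hc : ContinuousOn φ'' (Ici 0)) (hsub : ∀ σ, 0 ≤ σ → 0 ≤ 4 * σ * φ'' σ + 2 * d * φ' σ)
    (b : ℝ) : MonotoneOn (sphereMean μ i φ b) (Ici 0) := by
  obtain ⟨m, hm⟩ := Nat.exists_eq_add_of_le' hd
  have hφc : ContinuousOn φ' (Ici 0) := fun σ hσ => (hφ' σ hσ).continuousAt.continuousWithinAt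
  have hder := hμ.hasDerivAt_sphereMean (i := i) hφ hφc b
  refine monotoneOn_of_deriv_nonneg (convex_Ici 0)
    (fun r _ => (hder r).continuousAt.continuousWithinAt)
    (fun r _ => (hder r).differentiableAt.differentiableWithinAt) fun r hr => ?_
  rw [interior_Ici] at hr
  rw [(hder r).deriv]
  exact nonneg_of_hasDerivAt_pow_mul
    (hμ.hasDerivAt_pow_mul_deriv_sphereMean hm hφ' hc b)
    (fun r _ => hμ.sphereMean_nonneg hsub b r) hr

/-- Spherical means of a bisubharmonic radial function are convex in the squared radius. -/
theorem convexOn_sphereMean_sqrt [IsProbabilityMeasure μ] (hμ : IsUniformOnSphere μ) (hd : 2 ≤ d)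
    {ψ ψ' ψ'' : ℝ → ℝ}
    (hφ : ∀ σ, 0 ≤ σ → HasDerivAt φ (φ' σ) σ) (hφ' : ∀ σ, 0 ≤ σ → HasDerivAt φ' (φ'' σ) σ)
    (hc : ContinuousOn φ'' (Ici 0)) (hlap : ∀ σ, 0 ≤ σ → 4 * σ * φ'' σ + 2 * d * φ' σ = ψ σ)
    (hψ : ∀ σ, 0 ≤ σ → HasDerivAt ψ (ψ' σ) σ) (hψ' : ∀ σ, 0 ≤ σ → HasDerivAt ψ' (ψ'' σ) σ)
    (hψc : ContinuousOn ψ'' (Ici 0)) (hsub : ∀ σ, 0 ≤ σ → 0 ≤ 4 * σ * ψ'' σ + 2 * d * ψ' σ)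
    (b : ℝ) : ConvexOn ℝ (Ici 0) fun τ => sphereMean μ i φ b (√τ) := by
  obtain ⟨m, hm⟩ := Nat.exists_eq_add_of_le' hd
  have hφc : ContinuousOn φ' (Ici 0) := fun σ hσ => (hφ' σ hσ).continuousAt.continuousWithinAt
  refine convexOn_comp_sqrt (hμ.hasDerivAt_sphereMean (i := i) hφ hφc b)
    (monotoneOn_div_of_hasDerivAt_pow_mul
      (hμ.hasDerivAt_pow_mul_deriv_sphereMean hm hφ' hc b) ?_)
  refine (hμ.monotoneOn_sphereMean (i := i) hd hψ hψ' hψc hsub b).congr fun r _ => ?_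
  exact (hμ.sphereMean_congr hlap b r).symm

end IsUniformOnSphere


theorem hasDerivAt_const_mul_add_rpow {ε : ℝ} (hε : 0 < ε) (c a : ℝ) {σ : ℝ} (hσ : 0 ≤ σ) :
    HasDerivAt (fun σ => c * (σ + ε) ^ a) (c * a * (σ + ε) ^ (a - 1)) σ := by
  refine ((((hasDerivAt_id σ).add_const ε).rpow_const (p := a)
    (Or.inl (by simp only [id]; positivity))).const_mul c).congr_deriv ?_
  simp only [id]
  ring

theorem continuousOn_const_mul_add_rpow {ε : ℝ} (hε : 0 < ε) (c a : ℝ) :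
    ContinuousOn (fun σ : ℝ => c * (σ + ε) ^ a) (Ici 0) := fun _ hσ =>
  (hasDerivAt_const_mul_add_rpow hε c a hσ).continuousAt.continuousWithinAt

theorem ConvexOn.add_le_add_of_abs_le {F : ℝ → ℝ} (hF : ConvexOn ℝ (Ici 0) F) {s t t' : ℝ}
    (htt' : |t| ≤ |t'|) (ht' : |t'| ≤ s) : F (s + t) + F (s - t) ≤ F (s + t') + F (s - t') := by
  rcases eq_or_ne t' 0 with rfl | h0
  · rw [abs_zero, abs_nonpos_iff] at htt'
    rw [htt']
  have hq : |t / t'| ≤ 1 := by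
    rw [abs_div]
    exact div_le_one_of_le₀ htt' (abs_nonneg _)
  rw [abs_le] at hq ht'
  have hp : s + t' ∈ Ici (0 : ℝ) := mem_Ici.2 (by linarith)
  have hm : s - t' ∈ Ici (0 : ℝ) := mem_Ici.2 (by linarith)
  have h1 := hF.2 hp hm (show 0 ≤ (1 + t / t') / 2 by linarith)
    (show 0 ≤ (1 - t / t') / 2 by linarith) (by ring)
  have h2 := hF.2 hp hm (show 0 ≤ (1 - t / t') / 2 by linarith)
    (show 0 ≤ (1 + t / t') / 2 by linarith) (by ring)
  have e : t / t' * t' = t := div_mul_cancel₀ _ h0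
  simp only [smul_eq_mul] at h1 h2
  rw [show (1 + t / t') / 2 * (s + t') + (1 - t / t') / 2 * (s - t') = s + t by
    linear_combination e] at h1
  rw [show (1 - t / t') / 2 * (s + t') + (1 + t / t') / 2 * (s - t') = s - t by
    linear_combination -e] at h2
  linarith

theorem exists_linearIsometryEquiv_apply_eq {d : ℕ} {v w : EuclideanSpace ℝ (Fin d)}
    (h : ‖v‖ = ‖w‖) :
    ∃ Q : EuclideanSpace ℝ (Fin d) ≃ₗᵢ[ℝ] EuclideanSpace ℝ (Fin d), Q v = w :=
  ⟨_, Submodule.reflection_sub h⟩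

namespace IsUniformOnSphere

variable {d : ℕ} {μ : Measure (EuclideanSpace ℝ (Fin d))} {i : Fin d}

/-- The function `(‖x‖ ^ 2 + ε) ^ (-q)` is bisubharmonic on `ℝ ^ d` when `2 * q + 4 ≤ d`, so its
spherical means are convex in the squared radius. -/
theorem convexOn_sphereMean_rpow [IsProbabilityMeasure μ] (hμ : IsUniformOnSphere μ) {ε q : ℝ} (hε : 0 < ε) (hq : 0 < q)
    (hqd : 2 * q + 4 ≤ d) (b : ℝ) :
    ConvexOn ℝ (Ici 0) fun τ => sphereMean μ i (fun σ => (σ + ε) ^ (-q)) b (√τ) := by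
  have hd : 2 ≤ d := by
    have : (2 : ℝ) ≤ d := by linarith
    exact_mod_cast this
  set A : ℝ := q * (4 * (q + 1) - 2 * d) with hA
  set B : ℝ := -(4 * ε * (q * (q + 1))) with hB
  have hp : ∀ {σ : ℝ}, 0 ≤ σ → 0 < σ + ε := fun h => by positivity
  refine hμ.convexOn_sphereMean_sqrt hd
    (φ' := fun σ => 1 * (-q) * (σ + ε) ^ (-q - 1))
    (φ'' := fun σ => 1 * (-q) * (-q - 1) * (σ + ε) ^ (-q - 1 - 1))
    (ψ := fun σ => A * (σ + ε) ^ (-q - 1) + B * (σ + ε) ^ (-q - 2))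
    (ψ' := fun σ => A * (-q - 1) * (σ + ε) ^ (-q - 1 - 1) +
      B * (-q - 2) * (σ + ε) ^ (-q - 2 - 1))
    (ψ'' := fun σ => A * (-q - 1) * (-q - 1 - 1) * (σ + ε) ^ (-q - 1 - 1 - 1) +
      B * (-q - 2) * (-q - 2 - 1) * (σ + ε) ^ (-q - 2 - 1 - 1))
    ?_ ?_ ?_ ?_ ?_ ?_ ?_ ?_ b
  · intro σ hσ
    simpa only [one_mul] using hasDerivAt_const_mul_add_rpow hε 1 (-q) hσ
  · intro σ hσ
    exact hasDerivAt_const_mul_add_rpow hε _ _ hσ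
  · exact continuousOn_const_mul_add_rpow hε _ _
  · intro σ hσ
    have e1 : (σ + ε) ^ (-q - 1) = (σ + ε) ^ (-q - 2) * (σ + ε) := by
      rw [← rpow_add_one (hp hσ).ne']
      ring_nf
    have e2 : (σ + ε) ^ (-q - 1 - 1) = (σ + ε) ^ (-q - 2) := by ring_nf
    simp only [e1, e2, hA, hB]
    ring
  · intro σ hσ
    exact (hasDerivAt_const_mul_add_rpow hε _ _ hσ).add (hasDerivAt_const_mul_add_rpow hε _ _ hσ)
  · intro σ hσ
    exact (hasDerivAt_const_mul_add_rpow hε _ _ hσ).add (hasDerivAt_const_mul_add_rpow hε _ _ hσ)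
  · exact (continuousOn_const_mul_add_rpow hε _ _).add (continuousOn_const_mul_add_rpow hε _ _)
  · intro σ hσ
    have e1 : (σ + ε) ^ (-q - 1 - 1) = (σ + ε) ^ (-q - 2 - 1 - 1) * (σ + ε) * (σ + ε) := by
      rw [← rpow_add_one (hp hσ).ne', ← rpow_add_one (hp hσ).ne']
      ring_nf
    have e2 : (σ + ε) ^ (-q - 1 - 1 - 1) = (σ + ε) ^ (-q - 2 - 1 - 1) * (σ + ε) := by
      rw [← rpow_add_one (hp hσ).ne']
      ring_nf
    have e3 : (σ + ε) ^ (-q - 2 - 1) = (σ + ε) ^ (-q - 2 - 1 - 1) * (σ + ε) := by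
      rw [← rpow_add_one (hp hσ).ne']
      ring_nf
    simp only [e1, e2, e3]
    have hR : 0 ≤ (σ + ε) ^ (-q - 2 - 1 - 1) := (rpow_pos_of_pos (hp hσ) _).le
    have key : 0 ≤ q * (q + 1) * ((2 * d - 4 * (q + 1)) * (2 * d - 4 * (q + 2)) * (σ + ε) ^ 2 +
        8 * ε * (q + 2) * (2 * d - 4 * (q + 2)) * (σ + ε) +
        16 * ε ^ 2 * (q + 2) * (q + 3)) := by
      have h1 : 0 ≤ 2 * d - 4 * (q + 1) := by linarith
      have h2 : 0 ≤ 2 * d - 4 * (q + 2) := by linarith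
      have h3 := hp hσ
      positivity
    refine (mul_nonneg hR key).trans_eq ?_
    simp only [hA, hB]
    ring

theorem continuous_sphereMean_rpow [IsProbabilityMeasure μ] (hμ : IsUniformOnSphere μ) {ε : ℝ} (hε : 0 < ε) (q b : ℝ) :
    Continuous (sphereMean μ i (fun σ => (σ + ε) ^ (-q)) b) := by
  refine continuous_iff_continuousAt.2 fun r =>
    (hμ.hasDerivAt_sphereMean (φ' := fun σ => 1 * (-q) * (σ + ε) ^ (-q - 1)) ?_ ?_ b r).continuousAt
  · intro σ hσ
    simpa only [one_mul] using hasDerivAt_const_mul_add_rpow hε 1 (-q) hσ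
  · exact continuousOn_const_mul_add_rpow hε _ _

variable {φ : ℝ → ℝ}

theorem lintegral_eq_sphereMean [IsProbabilityMeasure μ] (hμ : IsUniformOnSphere μ) (i : Fin d)
    (hφc : ContinuousOn φ (Ici 0)) (hφ0 : ∀ σ, 0 ≤ σ → 0 ≤ φ σ) (b : ℝ)
    (x : EuclideanSpace ℝ (Fin d)) :
    ∫⁻ ζ, ENNReal.ofReal (φ (‖x + b • ζ‖ ^ 2)) ∂μ = ENNReal.ofReal (sphereMean μ i φ b ‖x‖) := by
  obtain ⟨Q, hQ⟩ := exists_linearIsometryEquiv_apply_eq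
    (v := x) (w := EuclideanSpace.single i ‖x‖) (by simp)
  have h1 : ∫⁻ ζ, ENNReal.ofReal (φ (‖x + b • ζ‖ ^ 2)) ∂μ =
      ∫⁻ ζ, ENNReal.ofReal (φ (‖EuclideanSpace.single i ‖x‖ + b • ζ‖ ^ 2)) ∂μ := by
    rw [← hμ.lintegral_comp Q fun ζ =>
      ENNReal.ofReal (φ (‖EuclideanSpace.single i ‖x‖ + b • ζ‖ ^ 2))]
    refine lintegral_congr fun ζ => ?_
    rw [← hQ, ← map_smul Q, ← map_add Q, LinearIsometryEquiv.norm_map]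
  rw [h1, sphereMean, ofReal_integral_eq_lintegral_ofReal]
  · refine lintegral_congr_ae ?_
    filter_upwards [hμ.ae_mem_sphere] with ζ hζ
    congr 2
    rw [norm_add_sq_real, norm_smul, mem_sphere_zero_iff_norm.1 hζ]
    simp [inner_smul_right, EuclideanSpace.inner_single_left]
    ring
  · exact hμ.integrable_of_continuousOn (continuousOn_comp_coord_right hφc b _)
  · filter_upwards [hμ.ae_mem_sphere] with ζ hζ
    exact hφ0 _ (sq_add_sq_add_nonneg _ b (coord_mem_Icc hζ i))

theorem lintegral_lintegral_add_eq_of_norm_eq (hμ : IsUniformOnSphere μ) (f : ℝ → ℝ≥0∞) (α β : ℝ)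
    {w w' : EuclideanSpace ℝ (Fin d)} (h : ‖w‖ = ‖w'‖) :
    ∫⁻ ξ, ∫⁻ η, f ‖α • ξ + β • η + w‖ ∂μ ∂μ = ∫⁻ ξ, ∫⁻ η, f ‖α • ξ + β • η + w'‖ ∂μ ∂μ := by
  obtain ⟨Q, rfl⟩ := exists_linearIsometryEquiv_apply_eq h
  rw [← hμ.lintegral_comp Q fun ξ => ∫⁻ η, f ‖α • ξ + β • η + Q w‖ ∂μ]
  refine lintegral_congr fun ξ => ?_
  rw [← hμ.lintegral_comp Q fun η => f ‖α • Q ξ + β • η + Q w‖]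
  refine lintegral_congr fun η => ?_
  rw [← map_smul, ← map_smul, ← map_add, ← map_add, LinearIsometryEquiv.norm_map]

theorem lintegral_lintegral_eq_sphereMean [IsProbabilityMeasure μ] (hμ : IsUniformOnSphere μ) (i : Fin d)
    (hφm : Measurable φ)
    (hφc : ContinuousOn φ (Ici 0)) (hφ0 : ∀ σ, 0 ≤ σ → 0 ≤ φ σ) (α β : ℝ)
    (w : EuclideanSpace ℝ (Fin d)) :
    ∫⁻ ξ, ∫⁻ η, ENNReal.ofReal (φ (‖α • ξ + β • η + w‖ ^ 2)) ∂μ ∂μ =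
      ∫⁻ ξ, ∫⁻ η, ENNReal.ofReal (sphereMean μ i φ ‖w‖ ‖α • ξ + β • η‖) ∂μ ∂μ := by
  calc ∫⁻ ξ, ∫⁻ η, ENNReal.ofReal (φ (‖α • ξ + β • η + w‖ ^ 2)) ∂μ ∂μ
      = ∫⁻ _ζ, ∫⁻ ξ, ∫⁻ η, ENNReal.ofReal (φ (‖α • ξ + β • η + w‖ ^ 2)) ∂μ ∂μ ∂μ := by simp
    _ = ∫⁻ ζ, ∫⁻ ξ, ∫⁻ η, ENNReal.ofReal (φ (‖α • ξ + β • η + ‖w‖ • ζ‖ ^ 2)) ∂μ ∂μ ∂μ := by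
        refine lintegral_congr_ae ?_
        filter_upwards [hμ.ae_mem_sphere] with ζ hζ
        refine hμ.lintegral_lintegral_add_eq_of_norm_eq (fun r => ENNReal.ofReal (φ (r ^ 2))) α β ?_
        rw [norm_smul, mem_sphere_zero_iff_norm.1 hζ]
        simp
    _ = ∫⁻ ξ, ∫⁻ ζ, ∫⁻ η, ENNReal.ofReal (φ (‖α • ξ + β • η + ‖w‖ • ζ‖ ^ 2)) ∂μ ∂μ ∂μ := by
        refine lintegral_lintegral_swap (Measurable.aemeasurable ?_)
        refine Measurable.lintegral_prod_right' (f := fun z : (EuclideanSpace ℝ (Fin d) ×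
          EuclideanSpace ℝ (Fin d)) × EuclideanSpace ℝ (Fin d) =>
          ENNReal.ofReal (φ (‖α • z.1.2 + β • z.2 + ‖w‖ • z.1.1‖ ^ 2))) ?_
        exact (hφm.comp (Continuous.measurable (by fun_prop))).ennreal_ofReal
    _ = ∫⁻ ξ, ∫⁻ η, ∫⁻ ζ, ENNReal.ofReal (φ (‖α • ξ + β • η + ‖w‖ • ζ‖ ^ 2)) ∂μ ∂μ ∂μ := by
        refine lintegral_congr fun ξ => lintegral_lintegral_swap (Measurable.aemeasurable ?_)
        exact (hφm.comp (Continuous.measurable (by fun_prop))).ennreal_ofReal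
    _ = _ := by
        refine lintegral_congr fun ξ => lintegral_congr fun η => ?_
        exact hμ.lintegral_eq_sphereMean i hφc hφ0 _ _

theorem lintegral_convexOn_inner_le (hμ : IsUniformOnSphere μ) {F : ℝ → ℝ}
    (hF : ConvexOn ℝ (Ici 0) F) (hFm : Measurable F) (hF0 : ∀ τ, 0 ≤ F τ) {s c c' : ℝ}
    (hc : 0 ≤ c) (hcc' : c ≤ c') (hc' : c' ≤ s)
    {ξ : EuclideanSpace ℝ (Fin d)} (hξ : ξ ∈ Metric.sphere 0 1) :
    ∫⁻ η, ENNReal.ofReal (F (s + c * inner ℝ ξ η)) ∂μ ≤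
      ∫⁻ η, ENNReal.ofReal (F (s + c' * inner ℝ ξ η)) ∂μ := by
  have hdouble : ∀ c : ℝ, 2 * ∫⁻ η, ENNReal.ofReal (F (s + c * inner ℝ ξ η)) ∂μ =
      ∫⁻ η, ENNReal.ofReal (F (s + c * inner ℝ ξ η) + F (s - c * inner ℝ ξ η)) ∂μ := by
    intro c
    have hneg : ∫⁻ η, ENNReal.ofReal (F (s + c * inner ℝ ξ η)) ∂μ =
        ∫⁻ η, ENNReal.ofReal (F (s - c * inner ℝ ξ η)) ∂μ := by
      rw [← hμ.lintegral_comp (LinearIsometryEquiv.neg ℝ)]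
      refine lintegral_congr fun η => ?_
      simp [sub_eq_add_neg]
    rw [two_mul]
    nth_rw 2 [hneg]
    rw [← lintegral_add_left]
    · refine lintegral_congr fun η => ?_
      rw [ENNReal.ofReal_add (hF0 _) (hF0 _)]
    · exact (hFm.comp (Continuous.measurable (by fun_prop))).ennreal_ofReal
  rw [← ENNReal.mul_le_mul_iff_right (two_ne_zero) (ENNReal.ofNat_ne_top (n := 2)), hdouble c,
    hdouble c']
  refine lintegral_mono_ae ?_
  filter_upwards [hμ.ae_mem_sphere] with η hη
  refine ENNReal.ofReal_le_ofReal (hF.add_le_add_of_abs_le ?_ ?_)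
  · rw [abs_mul, abs_mul, abs_of_nonneg hc, abs_of_nonneg (hc.trans hcc')]
    gcongr
  · rw [abs_mul, abs_of_nonneg (hc.trans hcc')]
    have h := abs_real_inner_le_norm ξ η
    rw [mem_sphere_zero_iff_norm.1 hξ, mem_sphere_zero_iff_norm.1 hη, one_mul] at h
    exact (mul_le_of_le_one_right (hc.trans hcc') h).trans hc'

theorem norm_smul_add_smul {α β : ℝ} {ξ η : EuclideanSpace ℝ (Fin d)}
    (hξ : ξ ∈ Metric.sphere 0 1) (hη : η ∈ Metric.sphere 0 1) :
    ‖α • ξ + β • η‖ = √(α ^ 2 + β ^ 2 + 2 * (α * β) * inner ℝ ξ η) := by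
  rw [← sqrt_sq (norm_nonneg (α • ξ + β • η)), norm_add_sq_real, norm_smul, norm_smul,
    mem_sphere_zero_iff_norm.1 hξ, mem_sphere_zero_iff_norm.1 hη, inner_smul_left,
    inner_smul_right]
  congr 1
  simp
  ring

/-- Making two coefficients closer to each other increases the regularized negative moment. -/
theorem lintegral_lintegral_rpow_le [IsProbabilityMeasure μ] (hμ : IsUniformOnSphere μ) {ε q : ℝ} (hε : 0 < ε)
    (hq : 0 < q) (hqd : 2 * q + 4 ≤ d) {a b a' b' : ℝ} (ha : 0 ≤ a) (hb : 0 ≤ b) (ha' : 0 ≤ a')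
    (hb' : 0 ≤ b') (hsum : a + b = a' + b') (hprod : a * b ≤ a' * b')
    (w : EuclideanSpace ℝ (Fin d)) :
    ∫⁻ ξ, ∫⁻ η, ENNReal.ofReal ((‖√a • ξ + √b • η + w‖ ^ 2 + ε) ^ (-q)) ∂μ ∂μ ≤
      ∫⁻ ξ, ∫⁻ η, ENNReal.ofReal ((‖√a' • ξ + √b' • η + w‖ ^ 2 + ε) ^ (-q)) ∂μ ∂μ := by
  have hd : 0 < d := by
    have : (0 : ℝ) < d := by linarith
    exact_mod_cast this
  set i : Fin d := ⟨0, hd⟩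
  have hφm : Measurable fun σ : ℝ => (σ + ε) ^ (-q) := by fun_prop
  have hφc : ContinuousOn (fun σ : ℝ => (σ + ε) ^ (-q)) (Ici 0) := by
    simpa only [one_mul] using continuousOn_const_mul_add_rpow hε 1 (-q)
  have hφ0 : ∀ σ : ℝ, 0 ≤ σ → 0 ≤ (σ + ε) ^ (-q) := fun σ hσ => by positivity
  have key : ∀ {a b : ℝ}, 0 ≤ a → 0 ≤ b →
      ∫⁻ ξ, ∫⁻ η, ENNReal.ofReal ((‖√a • ξ + √b • η + w‖ ^ 2 + ε) ^ (-q)) ∂μ ∂μ =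
      ∫⁻ ξ, ∫⁻ η, ENNReal.ofReal (sphereMean μ i (fun σ : ℝ => (σ + ε) ^ (-q)) ‖w‖
        √(a + b + 2 * (√a * √b) * inner ℝ ξ η)) ∂μ ∂μ := by
    intro a b ha hb
    rw [hμ.lintegral_lintegral_eq_sphereMean i hφm hφc hφ0]
    refine lintegral_congr_ae ?_
    filter_upwards [hμ.ae_mem_sphere] with ξ hξ
    refine lintegral_congr_ae ?_
    filter_upwards [hμ.ae_mem_sphere] with η hη
    rw [norm_smul_add_smul hξ hη, sq_sqrt ha, sq_sqrt hb]
  rw [key ha hb, key ha' hb', hsum]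
  refine lintegral_mono_ae ?_
  filter_upwards [hμ.ae_mem_sphere] with ξ hξ
  refine hμ.lintegral_convexOn_inner_le (hμ.convexOn_sphereMean_rpow (i := i) hε hq hqd ‖w‖)
    ((hμ.continuous_sphereMean_rpow hε q ‖w‖).comp continuous_sqrt).measurable
    (fun τ => hμ.sphereMean_nonneg hφ0 _ _) (by positivity) ?_ ?_ hξ
  · rw [← sqrt_mul ha, ← sqrt_mul ha']
    gcongr
  · nlinarith [sq_nonneg (√a' - √b'), sq_sqrt ha', sq_sqrt hb']

end IsUniformOnSphere


section Majorization

variable {n : ℕ}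

/-- For a nonincreasing tuple, no set of indices has a larger sum than the initial segment of the
same size. -/
theorem Antitone.sum_le_sum_Iic {z : Fin n → ℝ} (hz : Antitone z) (m : Fin n)
    {T : Finset (Fin n)} (hT : T.card = (Finset.Iic m).card) :
    ∑ i ∈ T, z i ≤ ∑ i ∈ Finset.Iic m, z i := by
  have h1 : ∑ i ∈ T, (z i - z m) ≤ ∑ i ∈ Finset.Iic m, (z i - z m) := by
    calc ∑ i ∈ T, (z i - z m) ≤ ∑ i ∈ T, max (z i - z m) 0 :=
          Finset.sum_le_sum fun i _ => le_max_left _ _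
      _ ≤ ∑ i, max (z i - z m) 0 :=
          Finset.sum_le_sum_of_subset_of_nonneg (Finset.subset_univ _) fun i _ _ => le_max_right _ _
      _ = ∑ i ∈ Finset.Iic m, max (z i - z m) 0 := by
          refine (Finset.sum_subset (Finset.subset_univ _) fun i _ hi => ?_).symm
          rw [Finset.mem_Iic, not_le] at hi
          exact max_eq_right (sub_nonpos.2 (hz hi.le))
      _ = ∑ i ∈ Finset.Iic m, (z i - z m) := by
          refine Finset.sum_congr rfl fun i hi => max_eq_left (sub_nonneg.2 (hz ?_))
          exact Finset.mem_Iic.1 hi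
  simp only [Finset.sum_sub_distrib, Finset.sum_const, hT] at h1
  linarith

variable {H : (Fin n → ℝ) → ℝ≥0∞}

/-- A functional that does not decrease under transfers making two entries closer is monotone
along majorization, expressed through the partial sums relative to a nonincreasing tuple. -/
theorem le_of_sum_Iic_le
    (htrans : ∀ (j k : Fin n) (y y' : Fin n → ℝ), j ≠ k → (∀ i, 0 ≤ y i) → (∀ i, 0 ≤ y' i) →
      (∀ i, i ≠ j → i ≠ k → y' i = y i) → y j + y k = y' j + y' k → y j * y k ≤ y' j * y' k →
      H y ≤ H y')
    {x : Fin n → ℝ} (hx : ∀ i, 0 ≤ x i) (hanti : Antitone x) (y : Fin n → ℝ) (hy : ∀ i, 0 ≤ y i)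
    (hpart : ∀ m, ∑ i ∈ Finset.Iic m, x i ≤ ∑ i ∈ Finset.Iic m, y i)
    (hsum : ∑ i, x i = ∑ i, y i) : H y ≤ H x := by
  induction hN : (Finset.univ.filter fun i => x i ≠ y i).card using Nat.strong_induction_on
    generalizing y with
  | _ N ih =>
  by_cases hxy : x = y
  · rw [hxy]
  have hk : ∃ k, y k < x k := by
    by_contra! hle
    exact hxy (funext fun i =>
      (Finset.sum_eq_sum_iff_of_le fun i _ => hle i).1 hsum i (Finset.mem_univ i))
  obtain ⟨k, hk, hkmin⟩ : ∃ k, y k < x k ∧ ∀ i < k, x i ≤ y i := by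
    obtain ⟨k, hk⟩ := (Set.toFinite {k | y k < x k}).exists_minimal hk
    refine ⟨k, hk.prop, fun i hi => ?_⟩
    by_contra! h
    exact absurd (hk.le_of_le h hi.le) (not_le.2 hi)
  obtain ⟨j, hjk, hj⟩ : ∃ j < k, x j < y j := by
    by_contra! hle
    refine absurd (hpart k) (not_le.2 (Finset.sum_lt_sum (fun i hi => ?_)
      ⟨k, Finset.mem_Iic.2 le_rfl, hk⟩))
    rcases (Finset.mem_Iic.1 hi).lt_or_eq with h | rfl
    · exact hle i h
    · exact hk.le
  set δ : ℝ := min (y j - x j) (x k - y k) with hδ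
  have hδj : δ ≤ y j - x j := min_le_left _ _
  have hδk : δ ≤ x k - y k := min_le_right _ _
  have hδ0 : 0 < δ := lt_min (sub_pos.2 hj) (sub_pos.2 hk)
  set y' : Fin n → ℝ := fun i => y i - (if i = j then δ else 0) + (if i = k then δ else 0) with hy'
  have hy'j : y' j = y j - δ := by simp [hy', hjk.ne]
  have hy'k : y' k = y k + δ := by simp [hy', hjk.ne']
  have hy'i : ∀ i, i ≠ j → i ≠ k → y' i = y i := fun i h1 h2 => by simp [hy', h1, h2]
  have hy'0 : ∀ i, 0 ≤ y' i := by
    intro i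
    by_cases h1 : i = j
    · subst h1
      linarith [hx i]
    by_cases h2 : i = k
    · subst h2
      linarith [hy i]
    rw [hy'i i h1 h2]
    exact hy i
  have hsum' : ∀ s : Finset (Fin n), ∑ i ∈ s, y' i =
      ∑ i ∈ s, y i - (if j ∈ s then δ else 0) + (if k ∈ s then δ else 0) := by
    intro s
    simp only [hy', Finset.sum_add_distrib, Finset.sum_sub_distrib, Finset.sum_ite_eq']
  refine (htrans j k y y' hjk.ne hy hy'0 hy'i (by rw [hy'j, hy'k]; ring) ?_).trans
    (ih _ ?_ y' hy'0 (fun m => ?_) ?_ rfl)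
  · rw [hy'j, hy'k]
    nlinarith [hanti hjk.le]
  · rw [← hN]
    refine Finset.card_lt_card (Finset.ssubset_iff_of_subset (fun i => ?_) |>.2 ?_)
    · simp only [Finset.mem_filter, Finset.mem_univ, true_and]
      by_cases h1 : i = j
      · subst h1
        exact fun _ => hj.ne
      by_cases h2 : i = k
      · subst h2
        exact fun _ => hk.ne'
      rw [hy'i i h1 h2]
      exact id
    · rcases min_choice (y j - x j) (x k - y k) with h | h
      · refine ⟨j, by simpa using hj.ne, ?_⟩
        simp [hy'j, hδ, h]
      · refine ⟨k, by simpa using hk.ne', ?_⟩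
        simp [hy'k, hδ, h]
  · rw [hsum']
    simp only [Finset.mem_Iic]
    have hm := hpart m
    by_cases hkm : k ≤ m
    · simpa [hkm, hjk.le.trans hkm] using hm
    by_cases hjm : j ≤ m
    · simp only [hjm, hkm, if_true, if_false, add_zero]
      have h1 := Finset.single_le_sum (f := fun i => y i - x i) (s := Finset.Iic m)
        (fun i hi => sub_nonneg.2 (hkmin i ((Finset.mem_Iic.1 hi).trans_lt (not_le.1 hkm))))
        (Finset.mem_Iic.2 hjm)
      simp only [Finset.sum_sub_distrib] at h1
      linarith
    · simpa [hkm, hjm] using hm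
  · rw [hsum', hsum]
    simp

theorem exists_perm_antitone (x : Fin n → ℝ) : ∃ σ : Equiv.Perm (Fin n), Antitone (x ∘ σ) :=
  ⟨Tuple.sort fun i => -x i, fun _ _ h => neg_le_neg_iff.1 (Tuple.monotone_sort (fun i => -x i) h)⟩

/-- A symmetric functional that does not decrease under transfers making two entries closer is
Schur-concave. -/
theorem MajorizedBy.le_of_perm_of_transfer
    (hperm : ∀ (σ : Equiv.Perm (Fin n)) (y : Fin n → ℝ), H (y ∘ σ) = H y)
    (htrans : ∀ (j k : Fin n) (y y' : Fin n → ℝ), j ≠ k → (∀ i, 0 ≤ y i) → (∀ i, 0 ≤ y' i) →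
      (∀ i, i ≠ j → i ≠ k → y' i = y i) → y j + y k = y' j + y' k → y j * y k ≤ y' j * y' k →
      H y ≤ H y')
    {x y : Fin n → ℝ} (hmaj : MajorizedBy x y) (hx : ∀ i, 0 ≤ x i) (hy : ∀ i, 0 ≤ y i) :
    H y ≤ H x := by
  obtain ⟨σ, hσ⟩ := exists_perm_antitone x
  obtain ⟨ρ, hρ⟩ := exists_perm_antitone y
  rw [← hperm σ x, ← hperm ρ y]
  refine le_of_sum_Iic_le htrans (fun i => hx _) hσ _ (fun i => hy _) (fun m => ?_) ?_
  · obtain ⟨T, hT, hle⟩ := hmaj.1 ((Finset.Iic m).map σ.toEmbedding)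
    rw [Finset.sum_map] at hle
    refine hle.trans ?_
    have h := hρ.sum_le_sum_Iic m (T := T.map ρ.symm.toEmbedding) (by simpa using hT)
    rw [Finset.sum_map] at h
    simpa using h
  · simp only [Function.comp_apply]
    rw [Equiv.sum_comp σ x, Equiv.sum_comp ρ y]
    exact hmaj.2

end Majorization

section Moments

variable {d n : ℕ} {μ : Measure (EuclideanSpace ℝ (Fin d))} [IsProbabilityMeasure μ]

theorem lintegral_pi_comp_perm (f : EuclideanSpace ℝ (Fin d) → ℝ≥0∞) (σ : Equiv.Perm (Fin n))
    (c : Fin n → ℝ) :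
    ∫⁻ ξ, f (∑ k, c (σ k) • ξ k) ∂(Measure.pi fun _ : Fin n => μ) =
      ∫⁻ ξ, f (∑ k, c k • ξ k) ∂(Measure.pi fun _ : Fin n => μ) := by
  have h := measurePreserving_piCongrLeft (fun _ : Fin n => μ) σ
  rw [← h.lintegral_comp_emb (MeasurableEquiv.measurableEmbedding _)
    fun ξ => f (∑ k, c k • ξ k)]
  refine lintegral_congr fun ξ => ?_
  congr 1
  rw [← Equiv.sum_comp σ fun k => c k • _]
  refine Finset.sum_congr rfl fun k _ => ?_
  rw [MeasurableEquiv.coe_piCongrLeft, Equiv.piCongrLeft_apply_apply]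

theorem sum_smul_update_update {j k : Fin n} (hjk : j ≠ k) (c : Fin n → ℝ)
    (ξ : Fin n → EuclideanSpace ℝ (Fin d)) (u v : EuclideanSpace ℝ (Fin d)) :
    ∑ i, c i • Function.update (Function.update ξ j u) k v i =
      c j • u + c k • v + ∑ i ∈ (Finset.univ.erase j).erase k, c i • ξ i := by
  rw [← Finset.add_sum_erase _ _ (Finset.mem_univ j),
    ← Finset.add_sum_erase _ _ (Finset.mem_erase.2 ⟨hjk.symm, Finset.mem_univ k⟩), ← add_assoc]
  congr 1
  · simp [Function.update_of_ne hjk]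
  · refine Finset.sum_congr rfl fun i hi => ?_
    rw [Finset.mem_erase, Finset.mem_erase] at hi
    rw [Function.update_of_ne hi.1, Function.update_of_ne hi.2.1]

theorem lintegral_pi_rpow_le_of_transfer (hμ : IsUniformOnSphere μ) {ε q : ℝ} (hε : 0 < ε)
    (hq : 0 < q) (hqd : 2 * q + 4 ≤ d) (j k : Fin n) (y y' : Fin n → ℝ) (hjk : j ≠ k)
    (hy : ∀ i, 0 ≤ y i) (hy' : ∀ i, 0 ≤ y' i) (heq : ∀ i, i ≠ j → i ≠ k → y' i = y i)
    (hsum : y j + y k = y' j + y' k) (hprod : y j * y k ≤ y' j * y' k) :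
    ∫⁻ ξ, ENNReal.ofReal ((‖∑ i, √(y i) • ξ i‖ ^ 2 + ε) ^ (-q)) ∂(Measure.pi fun _ : Fin n => μ) ≤
      ∫⁻ ξ, ENNReal.ofReal ((‖∑ i, √(y' i) • ξ i‖ ^ 2 + ε) ^ (-q))
        ∂(Measure.pi fun _ : Fin n => μ) := by
  have hm : ∀ y : Fin n → ℝ, Measurable fun ξ : Fin n → EuclideanSpace ℝ (Fin d) =>
      ENNReal.ofReal ((‖∑ i, √(y i) • ξ i‖ ^ 2 + ε) ^ (-q)) := fun y => by fun_prop
  refine lintegral_le_of_lmarginal_le (insert j {k}) (hm y) (hm y') fun ξ => ?_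
  have hj : j ∉ ({k} : Finset (Fin n)) := by simpa using hjk
  rw [lmarginal_insert _ (hm y) hj, lmarginal_insert _ (hm y') hj]
  simp only [lmarginal_singleton, sum_smul_update_update hjk]
  have hrest : ∑ i ∈ (Finset.univ.erase j).erase k, √(y' i) • ξ i =
      ∑ i ∈ (Finset.univ.erase j).erase k, √(y i) • ξ i := by
    refine Finset.sum_congr rfl fun i hi => ?_
    rw [Finset.mem_erase, Finset.mem_erase] at hi
    rw [heq i hi.2.1 hi.1]
  rw [hrest]
  exact hμ.lintegral_lintegral_rpow_le hε hq hqd (hy j) (hy k) (hy' j) (hy' k) hsum hprod _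

theorem ofReal_sq_add_rpow {ε : ℝ} (hε : 0 < ε) (q : ℝ) (v : EuclideanSpace ℝ (Fin d)) :
    ENNReal.ofReal ((‖v‖ ^ 2 + ε) ^ (-q)) = ((‖v‖₊ : ℝ≥0∞) ^ 2 + ENNReal.ofReal ε) ^ (-q) := by
  rw [← ENNReal.ofReal_rpow_of_pos (by positivity), ENNReal.ofReal_add (by positivity) hε.le,
    ENNReal.ofReal_pow (norm_nonneg v), ofReal_norm]
  rfl

theorem sq_rpow_neg_half (p : ℝ) (v : EuclideanSpace ℝ (Fin d)) :
    ((‖v‖₊ : ℝ≥0∞) ^ 2) ^ (-(p / 2)) = (‖v‖₊ : ℝ≥0∞) ^ (-p) := by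
  rw [← ENNReal.rpow_natCast, ← ENNReal.rpow_mul]
  congr 1
  push_cast
  ring

theorem ofReal_sq_add_rpow_le {ε p : ℝ} (hε : 0 < ε) (hp : 0 < p)
    (v : EuclideanSpace ℝ (Fin d)) :
    ENNReal.ofReal ((‖v‖ ^ 2 + ε) ^ (-(p / 2))) ≤ (‖v‖₊ : ℝ≥0∞) ^ (-p) := by
  rw [ofReal_sq_add_rpow hε, ← sq_rpow_neg_half, ENNReal.rpow_neg, ENNReal.rpow_neg]
  exact ENNReal.inv_le_inv.2 (ENNReal.rpow_le_rpow le_self_add (by positivity))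

theorem tendsto_ofReal_sq_add_rpow (p : ℝ) (v : EuclideanSpace ℝ (Fin d)) :
    Filter.Tendsto (fun m : ℕ => ENNReal.ofReal ((‖v‖ ^ 2 + 1 / ((m : ℝ) + 1)) ^ (-(p / 2))))
      Filter.atTop (nhds ((‖v‖₊ : ℝ≥0∞) ^ (-p))) := by
  have h1 : Filter.Tendsto (fun m : ℕ => (‖v‖₊ : ℝ≥0∞) ^ 2 + ENNReal.ofReal (1 / ((m : ℝ) + 1)))
      Filter.atTop (nhds ((‖v‖₊ : ℝ≥0∞) ^ 2)) := by
    have h := (ENNReal.tendsto_ofReal tendsto_one_div_add_atTop_nhds_zero_nat).const_add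
      ((‖v‖₊ : ℝ≥0∞) ^ 2)
    simpa using h
  have h2 := ((ENNReal.continuous_rpow_const (y := -(p / 2))).tendsto _).comp h1
  rw [sq_rpow_neg_half] at h2
  refine h2.congr fun m => ?_
  rw [ofReal_sq_add_rpow (by positivity)]
  rfl

end Moments

/-- Schur-concavity: for `d ≥ 5`, `0 < p ≤ d - 4`, if `x` is majorized by `y`
(entrywise nonnegative), then
`E|∑ √yₖ ξₖ|^{-p} ≤ E|∑ √xₖ ξₖ|^{-p}`. -/
theorem schur_concave_neg_moment
    (d : ℕ) (hd : 5 ≤ d) (p : ℝ) (hp : 0 < p) (hpd : p ≤ (d : ℝ) - 4)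
    (μ : Measure (EuclideanSpace ℝ (Fin d))) [IsProbabilityMeasure μ]
    (hμ : IsUniformOnSphere μ)
    (n : ℕ) (hn : 1 ≤ n) (x y : Fin n → ℝ)
    (hx : ∀ i, 0 ≤ x i) (hy : ∀ i, 0 ≤ y i) (hmaj : MajorizedBy x y) :
    ∫⁻ ξ, (‖∑ k, Real.sqrt (y k) • ξ k‖₊ : ℝ≥0∞) ^ (-p)
        ∂(Measure.pi fun _ : Fin n => μ)
      ≤ ∫⁻ ξ, (‖∑ k, Real.sqrt (x k) • ξ k‖₊ : ℝ≥0∞) ^ (-p)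
        ∂(Measure.pi fun _ : Fin n => μ) := by
  have hmono : ∀ {ε : ℝ}, 0 < ε →
      ∫⁻ ξ, ENNReal.ofReal ((‖∑ k, √(y k) • ξ k‖ ^ 2 + ε) ^ (-(p / 2)))
          ∂(Measure.pi fun _ : Fin n => μ) ≤
        ∫⁻ ξ, ENNReal.ofReal ((‖∑ k, √(x k) • ξ k‖ ^ 2 + ε) ^ (-(p / 2)))
          ∂(Measure.pi fun _ : Fin n => μ) := fun {ε} hε =>
    hmaj.le_of_perm_of_transfer
      (H := fun y => ∫⁻ ξ, ENNReal.ofReal ((‖∑ k, √(y k) • ξ k‖ ^ 2 + ε) ^ (-(p / 2)))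
        ∂(Measure.pi fun _ : Fin n => μ))
      (fun σ y => lintegral_pi_comp_perm
        (fun v => ENNReal.ofReal ((‖v‖ ^ 2 + ε) ^ (-(p / 2)))) σ fun k => √(y k))
      (lintegral_pi_rpow_le_of_transfer hμ hε (half_pos hp) (by linarith)) hx hy
  calc ∫⁻ ξ, (‖∑ k, √(y k) • ξ k‖₊ : ℝ≥0∞) ^ (-p) ∂(Measure.pi fun _ : Fin n => μ)
      = ∫⁻ ξ, Filter.liminf (fun m : ℕ => ENNReal.ofReal
          ((‖∑ k, √(y k) • ξ k‖ ^ 2 + 1 / ((m : ℝ) + 1)) ^ (-(p / 2)))) Filter.atTop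
          ∂(Measure.pi fun _ : Fin n => μ) :=
        lintegral_congr fun ξ => (tendsto_ofReal_sq_add_rpow p _).liminf_eq.symm
    _ ≤ Filter.liminf (fun m : ℕ => ∫⁻ ξ, ENNReal.ofReal
          ((‖∑ k, √(y k) • ξ k‖ ^ 2 + 1 / ((m : ℝ) + 1)) ^ (-(p / 2)))
          ∂(Measure.pi fun _ : Fin n => μ)) Filter.atTop :=
        lintegral_liminf_le fun m => by fun_prop
    _ ≤ Filter.liminf (fun _ : ℕ => ∫⁻ ξ, (‖∑ k, √(x k) • ξ k‖₊ : ℝ≥0∞) ^ (-p)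
          ∂(Measure.pi fun _ : Fin n => μ)) Filter.atTop :=
        Filter.liminf_le_liminf <| Filter.Eventually.of_forall fun m =>
          (hmono (by positivity)).trans
            (lintegral_mono fun ξ => ofReal_sq_add_rpow_le (by positivity) hp _)
    _ = _ := Filter.liminf_const _
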